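/- Let (N, τ) be a tracial von Neumann algebra, B ⊂ M ⊂ N von Neumann subalgebras, and for t = 1,…,m let ι_t(X_i), ι_t(X_j) ∈ N be such that Z_t := ι_t(X_i) ι₀(Y) ι_t(X_j) − ι₀(η_{i,j}(Y)) satisfy E_B[Z_t] = 0, the Z_t are free over B, and ‖Z_t‖ ≤ 8R‖Y‖ (which holds when ‖X_i‖, ‖X_j‖ ≤ 2R^{1/2} and ‖η_{i,j}(Y)‖ ≤ 4R‖Y‖). Then ‖(1/m) Σ_{t=1}^m ι_t(X_i) ι₀(Y) ι_t(X_j) − ι₀(η_{i,j}(Y))‖ ≤ 24 R ‖Y‖ / √m. -/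

import Mathlib

/-- Free independence with amalgamation over a subalgebra, with respect to a
conditional expectation `E`. -/
def FreelyIndependentOver {N : Type*} [Ring N] [StarRing N] [Algebra ℂ N]
    [StarModule ℂ N] {ι : Type*} (E : N →ₗ[ℂ] N) (A : ι → StarSubalgebra ℂ N) : Prop :=
  ∀ (k : ℕ) (idx : Fin (k + 1) → ι),
    (∀ j : Fin k, idx j.castSucc ≠ idx j.succ) →
    ∀ x : Fin (k + 1) → N, (∀ j, x j ∈ A (idx j)) → (∀ j, E (x j) = 0) →
      E (List.ofFn x).prod = 0

theorem norm_sq_sum_of_pairwise_inner_eq_zero {H ι : Type*} [SeminormedAddCommGroup H]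
    [InnerProductSpace ℂ H] (s : Finset ι) (x : ι → H)
    (hx : ∀ i ∈ s, ∀ j ∈ s, i ≠ j → inner ℂ (x i) (x j) = 0) :
    ‖∑ i ∈ s, x i‖ ^ 2 = ∑ i ∈ s, ‖x i‖ ^ 2 := by
  rw [← inner_self_eq_norm_sq (𝕜 := ℂ), sum_inner, map_sum]
  refine Finset.sum_congr rfl fun i hi => ?_
  rw [inner_sum, Finset.sum_eq_single_of_mem i hi fun j hj hji => hx i hi j hj hji.symm,
    inner_self_eq_norm_sq]

/-- If each `T t` maps every summand `V i` with `i ≠ some t` of an orthogonal sum into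
`V (some t)`, then `∑ t, T t` has norm of order `√m` on that sum. -/
theorem norm_sum_le_of_free_action {H ι : Type*} [SeminormedAddCommGroup H]
    [InnerProductSpace ℂ H] [Fintype ι] (V : Option ι → Submodule ℂ H)
    (hV : ∀ i j, i ≠ j → ∀ x ∈ V i, ∀ y ∈ V j, inner ℂ x y = 0)
    (T : ι → H →ₗ[ℂ] H) {K : ℝ} (hK : 0 ≤ K) (hTK : ∀ t x, ‖T t x‖ ≤ K * ‖x‖)
    (hTV : ∀ t i, i ≠ some t → ∀ x ∈ V i, T t x ∈ V (some t))
    (hTD : ∀ t, ∀ x ∈ V (some t), T t x ∈ ⨆ i, V i) {x : H} (hx : x ∈ ⨆ i, V i) :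
    ‖∑ t, T t x‖ ≤ (2 * √(Fintype.card ι) + 1) * K * ‖x‖ := by
  classical
  have decomp : ∀ y ∈ ⨆ i, V i, ∃ p : Option ι → H, (∀ i, p i ∈ V i) ∧ ∑ i, p i = y := by
    intro y hy
    have hy' : y ∈ ⨆ i ∈ (Finset.univ : Finset (Option ι)), V i := by simpa using hy
    obtain ⟨p, hp⟩ := (Submodule.mem_iSup_finset_iff_exists_sum V y).1 hy'
    exact ⟨fun i => p i, fun i => (p i).2, hp⟩
  have pyth : ∀ (s : Finset (Option ι)) (p : Option ι → H), (∀ i, p i ∈ V i) →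
      ‖∑ i ∈ s, p i‖ ^ 2 = ∑ i ∈ s, ‖p i‖ ^ 2 := fun s p hp =>
    norm_sq_sum_of_pairwise_inner_eq_zero s p fun i _ j _ hij => hV i j hij _ (hp i) _ (hp j)
  have pyth_some : ∀ p : ι → H, (∀ t, p t ∈ V (some t)) →
      ‖∑ t, p t‖ ^ 2 = ∑ t, ‖p t‖ ^ 2 := fun p hp =>
    norm_sq_sum_of_pairwise_inner_eq_zero _ p fun i _ j _ hij =>
      hV _ _ (by simpa using hij) _ (hp i) _ (hp j)
  have part_le : ∀ (s : Finset (Option ι)) (p : Option ι → H), (∀ i, p i ∈ V i) →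
      ‖∑ i ∈ s, p i‖ ≤ ‖∑ i, p i‖ := by
    intro s p hp
    rw [← sq_le_sq₀ (norm_nonneg _) (norm_nonneg _), pyth s p hp, pyth _ p hp]
    exact Finset.sum_le_univ_sum_of_nonneg fun i => sq_nonneg _
  obtain ⟨p, hp, rfl⟩ := decomp x hx
  set x := ∑ i, p i with hx_def
  choose q hq hqs using fun t => decomp _ (hTD t _ (hp (some t)))
  have hsum_p : ∑ t, ‖p (some t)‖ ^ 2 ≤ ‖x‖ ^ 2 := by
    rw [hx_def, pyth _ p hp, Fintype.sum_option]
    linarith [sq_nonneg ‖p none‖]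
  have split : ∀ t, T t x = q t (some t) + T t (∑ i ∈ Finset.univ.erase (some t), p i)
      + ∑ i ∈ Finset.univ.erase (some t), q t i := by
    intro t
    have h1 := hqs t
    rw [← Finset.add_sum_erase _ _ (Finset.mem_univ (some t))] at h1
    rw [hx_def, ← Finset.add_sum_erase _ _ (Finset.mem_univ (some t)), map_add, ← h1]
    abel
  have hdiag : ‖∑ t, q t (some t)‖ ≤ K * ‖x‖ := by
    rw [← sq_le_sq₀ (norm_nonneg _) (by positivity), pyth_some _ fun t => hq t _, mul_pow]
    calc ∑ t, ‖q t (some t)‖ ^ 2 ≤ ∑ t, K ^ 2 * ‖p (some t)‖ ^ 2 := by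
          refine Finset.sum_le_sum fun t _ => ?_
          rw [← mul_pow]
          gcongr
          calc ‖q t (some t)‖ ≤ ‖∑ i, q t i‖ := by
                simpa using part_le {some t} (q t) (hq t)
            _ ≤ _ := by rw [hqs]; exact hTK _ _
      _ ≤ K ^ 2 * ‖x‖ ^ 2 := by rw [← Finset.mul_sum]; gcongr
  have hcreate : ‖∑ t, T t (∑ i ∈ Finset.univ.erase (some t), p i)‖
      ≤ √(Fintype.card ι) * K * ‖x‖ := by
    rw [← sq_le_sq₀ (norm_nonneg _) (by positivity), pyth_some]
    · calc _ ≤ ∑ t : ι, (K * ‖x‖) ^ 2 := by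
            refine Finset.sum_le_sum fun t _ => ?_
            gcongr
            refine (hTK _ _).trans ?_
            gcongr
            exact part_le _ p hp
        _ = _ := by
            rw [mul_assoc, mul_pow (√_), Real.sq_sqrt (Nat.cast_nonneg _)]
            simp
    · intro t
      rw [map_sum]
      exact Submodule.sum_mem _ fun i hi => hTV t i (Finset.ne_of_mem_erase hi) _ (hp i)
  have hannihilate : ‖∑ t, ∑ i ∈ Finset.univ.erase (some t), q t i‖
      ≤ √(Fintype.card ι) * K * ‖x‖ := by
    calc _ ≤ ∑ t, K * ‖p (some t)‖ := by
          refine (norm_sum_le _ _).trans (Finset.sum_le_sum fun t _ => ?_)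
          refine (part_le _ (q t) (hq t)).trans ?_
          rw [hqs]
          exact hTK _ _
      _ = K * ∑ t, ‖p (some t)‖ := by rw [Finset.mul_sum]
      _ ≤ K * (√(Fintype.card ι) * ‖x‖) := by
          gcongr
          rw [← sq_le_sq₀ (by positivity) (by positivity), mul_pow,
            Real.sq_sqrt (Nat.cast_nonneg _)]
          refine (sq_sum_le_card_mul_sum_sq).trans ?_
          rw [Finset.card_univ]
          gcongr
      _ = _ := by ring
  simp_rw [split, Finset.sum_add_distrib]
  refine (norm_add₃_le).trans ?_
  linarith

/-- A complex linear map with self-adjoint values on all `star x * x` commutes with `star`. -/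
theorem LinearMap.map_star_of_isSelfAdjoint {A M : Type*} [Ring A] [StarRing A] [Algebra ℂ A]
    [StarModule ℂ A] [AddCommGroup M] [StarAddMonoid M] [Module ℂ M] [StarModule ℂ M]
    (f : A →ₗ[ℂ] M) (hf : ∀ x, IsSelfAdjoint (f (star x * x))) (x : A) :
    f (star x) = star (f x) := by
  have h1 := (hf (1 + x)).star_eq
  have h2 := (hf (1 + Complex.I • x)).star_eq
  have h3 := (hf x).star_eq
  have h4 := (hf 1).star_eq
  simp only [star_one, one_mul] at h4
  simp only [star_add, star_one, mul_add, add_mul, one_mul, mul_one, map_add, star_smul,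
    smul_mul_assoc, mul_smul_comm, map_smul, h3, h4, Complex.star_def, Complex.conj_I,
    map_neg, neg_neg] at h1 h2
  have e1 : star (f x) + star (f (star x)) = f x + f (star x) := by
    linear_combination (norm := module) h1
  have e2 : star (f x) - star (f (star x)) = f (star x) - f x := by
    have h5 : (-Complex.I) • (star (f x) - star (f (star x))) =
        (-Complex.I) • (f (star x) - f x) := by
      linear_combination (norm := module) h2
    exact smul_right_injective M (neg_ne_zero.2 Complex.I_ne_zero) h5
  have h6 : (2 : ℂ) • f (star x) = (2 : ℂ) • star (f x) := by
    simp only [two_smul]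
    linear_combination (norm := module) - e1 - e2
  exact smul_right_injective M two_ne_zero h6

open ComplexOrder in
/-- A left multiplication bound in the seminorm of a faithful state on a star subalgebra
containing the element is a bound on its operator norm. -/
theorem PositiveLinearMap.norm_le_of_preGNS_bound {A : Type*} [CStarAlgebra A] [PartialOrder A]
    [StarOrderedRing A] (f : A →ₚ[ℂ] ℂ) (hf : ∀ a, f (star a * a) = 0 → a = 0)
    (D : StarSubalgebra ℂ A) {S : A} (hS : S ∈ D) {C : ℝ} (hC : 0 ≤ C)
    (hD : ∀ x ∈ D, ‖f.toPreGNS (S * x)‖ ≤ C * ‖f.toPreGNS x‖) : ‖S‖ ≤ C := by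
  have hcont : Continuous fun x : A => f.toPreGNS x := by
    have h : ∀ x : A, ‖f.toPreGNS x‖ ≤ ‖f.toPreGNS 1‖ * ‖x‖ := fun x => by
      have hle := (f.leftMulMapPreGNS x).le_of_opNorm_le
        (LinearMap.mkContinuous_norm_le _ (norm_nonneg x) _) (f.toPreGNS 1)
      rw [leftMulMapPreGNS_apply] at hle
      simpa [mul_comm] using hle
    exact (f.toPreGNS.toLinearMap.mkContinuous _ h).continuous
  have hcl : ∀ x ∈ D.topologicalClosure, ‖f.toPreGNS (S * x)‖ ≤ C * ‖f.toPreGNS x‖ := by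
    intro x hx
    have hclosed : IsClosed {x | ‖f.toPreGNS (S * x)‖ ≤ C * ‖f.toPreGNS x‖} :=
      isClosed_le (hcont.comp (continuous_const.mul continuous_id)).norm
        (continuous_const.mul hcont.norm)
    exact closure_minimal (s := (D : Set A)) hD hclosed hx
  set a := star S * S with ha_def
  have ha : 0 ≤ a := star_mul_self_nonneg S
  have hsa : IsSelfAdjoint a := .of_nonneg ha
  have haD : a ∈ D.topologicalClosure :=
    D.le_topologicalClosure (mul_mem (star_mem hS) hS)
  let g : ℝ → ℝ := fun s => max (s - C ^ 2) 0
  let h : ℝ → ℝ := fun s => √(g s) * g s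
  have hg : Continuous g := by fun_prop
  have hh : Continuous h := by fun_prop
  have : IsClosed (D.topologicalClosure : Set A) := D.isClosed_topologicalClosure
  have hx := hcl (cfc g a) (cfc_mem g haD)
  set x := cfc g a with hx_def
  have hxs : star x = x := (cfc_predicate g a : IsSelfAdjoint x).star_eq
  have hyx : star (cfc h a) * cfc h a = star x * a * x - C ^ 2 • (star x * x) := by
    have hhs : star (cfc h a) = cfc h a := (cfc_predicate h a : IsSelfAdjoint _).star_eq
    have hfun : (fun s => h s * h s) = fun s => g s * s * g s - C ^ 2 * (g s * g s) := by
      ext s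
      have hg0 : 0 ≤ g s := le_max_right _ _
      have hgs : g s * g s = g s * (s - C ^ 2) := by
        rcases le_total (s - C ^ 2) 0 with hs | hs <;> simp [g, hs]
      calc h s * h s = (√(g s) * √(g s)) * (g s * g s) := by ring
        _ = g s * (g s * g s) := by rw [Real.mul_self_sqrt hg0]
        _ = _ := by linear_combination g s * hgs
    rw [hxs, hhs, ← cfc_mul h h a, hfun, cfc_sub _ _ a, cfc_const_mul _ _ a, cfc_mul _ _ a,
      cfc_mul _ _ a, cfc_mul g g a, cfc_id' ℝ a]
  have hfy : f (star (cfc h a) * cfc h a) =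
      ((‖f.toPreGNS (S * x)‖ ^ 2 - C ^ 2 * ‖f.toPreGNS x‖ ^ 2 : ℝ) : ℂ) := by
    rw [hyx, map_sub, ← Complex.coe_smul, map_smul, smul_eq_mul]
    push_cast
    rw [f.preGNS_norm_sq, f.preGNS_norm_sq]
    simp [ha_def, mul_assoc]
  have hle : ‖f.toPreGNS (S * x)‖ ^ 2 - C ^ 2 * ‖f.toPreGNS x‖ ^ 2 ≤ 0 := by
    rw [sub_nonpos, ← mul_pow]
    gcongr
  have hge : 0 ≤ f (star (cfc h a) * cfc h a) := f.map_nonneg (star_mul_self_nonneg _)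
  have hzero : cfc h a = 0 := by
    refine hf _ ?_
    rw [hfy, Complex.zero_le_real] at hge
    rw [hfy, le_antisymm hle hge, Complex.ofReal_zero]
  have hEq : (spectrum ℝ a).EqOn h 0 :=
    eqOn_of_cfc_eq_cfc (hzero.trans (cfc_zero ℝ a).symm) hh.continuousOn continuousOn_const
  have hspec : ∀ s ∈ spectrum ℝ a, s ≤ C ^ 2 := by
    intro s hs
    by_contra! hlt
    have hpos : 0 < g s := lt_max_of_lt_left (sub_pos.2 hlt)
    exact (mul_pos (Real.sqrt_pos.2 hpos) hpos).ne' (hEq hs)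
  have hnorm : ‖a‖ ≤ C ^ 2 := by
    rw [CStarAlgebra.norm_le_iff_le_algebraMap a (sq_nonneg C) ha,
      le_algebraMap_iff_spectrum_le]
    exact hspec
  rw [CStarRing.norm_star_mul_self, ← sq] at hnorm
  exact (sq_le_sq₀ (norm_nonneg _) hC).1 hnorm

theorem star_prod_map_snd {ι N : Type*} [Monoid N] [StarMul N]
    (l : List (ι × N)) :
    star (l.map Prod.snd).prod
      = ((l.reverse.map (fun p : ι × N => (p.1, star p.2))).map Prod.snd).prod := by
  induction l with
  | nil => simp
  | cons p l ih => simp_all [List.prod_append]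

section Words

variable {N : Type*} [Ring N] [StarRing N] [Algebra ℂ N] [StarModule ℂ N] {ι : Type*}

/-- A list of letters tagged with their algebras is reduced if neighbouring letters come from
different algebras and every letter is centered. -/
def IsReducedWord (E : N →ₗ[ℂ] N) (A : ι → StarSubalgebra ℂ N) (l : List (ι × N)) : Prop :=
  l.IsChain (fun p q => p.1 ≠ q.1) ∧ ∀ p ∈ l, p.2 ∈ A p.1 ∧ E p.2 = 0

/-- The span of the products of reduced words whose first letter lies in `A t`. -/
def wordSpace (E : N →ₗ[ℂ] N) (A : ι → StarSubalgebra ℂ N) (t : ι) : Submodule ℂ N :=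
  Submodule.span ℂ {y | ∃ a l, IsReducedWord E A ((t, a) :: l) ∧ a * (l.map Prod.snd).prod = y}

/-- The orthogonal summands of the algebraic free product: the base algebra, and the spaces of
reduced words sorted by their first letter. -/
def freeSummand (E : N →ₗ[ℂ] N) (A : ι → StarSubalgebra ℂ N) (B : StarSubalgebra ℂ N) :
    Option ι → Submodule ℂ N
  | none => Subalgebra.toSubmodule B.toSubalgebra
  | some t => wordSpace E A t

/-- The algebraic properties of a conditional expectation onto `B`. -/
structure IsConditionalExpectation (E : N →ₗ[ℂ] N) (B : StarSubalgebra ℂ N) : Prop where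
  mem (x : N) : E x ∈ B
  map_of_mem (b : N) (hb : b ∈ B) : E b = b
  map_mul_left (b : N) (hb : b ∈ B) (x : N) : E (b * x) = b * E x
  map_star (x : N) : E (star x) = star (E x)

variable {E : N →ₗ[ℂ] N} {A : ι → StarSubalgebra ℂ N} {B : StarSubalgebra ℂ N}

theorem FreelyIndependentOver.map_prod_eq_zero (hA : FreelyIndependentOver E A)
    {l : List (ι × N)} (hl : IsReducedWord E A l) (hne : l ≠ []) :
    E (l.map Prod.snd).prod = 0 := by
  obtain ⟨k, hk⟩ := Nat.exists_eq_succ_of_ne_zero (List.length_pos_iff.2 hne).ne'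
  have hlt : ∀ j : Fin (k + 1), (j : ℕ) < l.length := fun j => hk ▸ j.2
  have key := hA k (fun j => (l[j]'(hlt j)).1)
    (fun j => List.isChain_iff_getElem.1 hl.1 j (hlt j.succ))
    (fun j => (l[j]'(hlt j)).2) (fun j => (hl.2 _ (List.getElem_mem _)).1)
    (fun j => (hl.2 _ (List.getElem_mem _)).2)
  have hof : List.ofFn (fun j : Fin (k + 1) => (l[j]'(hlt j)).2) = l.map Prod.snd := by
    refine List.ext_getElem (by simp [hk]) fun i _ _ => ?_
    rw [List.getElem_ofFn, List.getElem_map]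
    rfl
  rwa [hof] at key

theorem IsReducedWord.reverse_star (hE : IsConditionalExpectation E B) {l : List (ι × N)}
    (hl : IsReducedWord E A l) :
    IsReducedWord E A (l.reverse.map (fun p : ι × N => (p.1, star p.2))) := by
  refine ⟨?_, ?_⟩
  · rw [List.isChain_map, List.isChain_reverse]
    exact hl.1.imp fun _ _ h => h.symm
  · intro p hp
    obtain ⟨q, hq, rfl⟩ := List.mem_map.1 hp
    obtain ⟨hq1, hq2⟩ := hl.2 q (List.mem_reverse.1 hq)
    exact ⟨star_mem hq1, by simp [hE.map_star, hq2]⟩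

/-- A linear map that vanishes on reduced words vanishes on `wordSpace`. -/
theorem map_eq_zero_of_mem_wordSpace {M : Type*} [AddCommGroup M] [Module ℂ M] (φ : N →ₗ[ℂ] M)
    {t : ι} (h : ∀ a l, IsReducedWord E A ((t, a) :: l) → φ (a * (l.map Prod.snd).prod) = 0)
    {y : N} (hy : y ∈ wordSpace E A t) : φ y = 0 := by
  have hle : wordSpace E A t ≤ LinearMap.ker φ := by
    refine Submodule.span_le.2 ?_
    rintro _ ⟨a, l, hl, rfl⟩
    exact h a l hl
  exact hle hy

theorem FreelyIndependentOver.map_eq_zero_of_mem_wordSpace (hA : FreelyIndependentOver E A)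
    {t : ι} {y : N} (hy : y ∈ wordSpace E A t) : E y = 0 :=
  _root_.map_eq_zero_of_mem_wordSpace E
    (fun a l hl => by simpa using hA.map_prod_eq_zero hl (List.cons_ne_nil _ _)) hy

theorem map_star_mul_eq_zero_of_mem_wordSpace (hE : IsConditionalExpectation E B)
    (hA : FreelyIndependentOver E A) {s t : ι} (hst : s ≠ t) {x y : N}
    (hx : x ∈ wordSpace E A s) (hy : y ∈ wordSpace E A t) : E (star x * y) = 0 := by
  induction hx using Submodule.span_induction with
  | zero => simp
  | add x₁ x₂ _ _ h₁ h₂ => simp [add_mul, h₁, h₂]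
  | smul c x _ h => simp [h]
  | mem x hx =>
    obtain ⟨a, l, hl, rfl⟩ := hx
    refine map_eq_zero_of_mem_wordSpace (E ∘ₗ LinearMap.mulLeft ℂ _) (fun b l' hl' => ?_) hy
    have hrev := hl.reverse_star hE
    have hword : IsReducedWord E A
        (((s, a) :: l).reverse.map (fun p : ι × N => (p.1, star p.2)) ++ (t, b) :: l') := by
      refine ⟨List.isChain_append.2 ⟨hrev.1, hl'.1, ?_⟩, ?_⟩
      · simpa using hst
      · intro p hp
        exact (List.mem_append.1 hp).elim (hrev.2 p) (hl'.2 p)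
    have hzero := hA.map_prod_eq_zero hword (by simp)
    rw [List.map_append, List.prod_append, ← star_prod_map_snd] at hzero
    simpa [mul_assoc] using hzero

theorem map_star_mul_eq_zero_of_mem_freeSummand (hE : IsConditionalExpectation E B)
    (hA : FreelyIndependentOver E A) {i j : Option ι} (hij : i ≠ j) {x y : N}
    (hx : x ∈ freeSummand E A B i) (hy : y ∈ freeSummand E A B j) : E (star x * y) = 0 := by
  have base : ∀ b ∈ B, ∀ t, ∀ y ∈ wordSpace E A t, E (star b * y) = 0 := fun b hb t y hy => by
    rw [hE.map_mul_left _ (star_mem hb), hA.map_eq_zero_of_mem_wordSpace hy, mul_zero]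
  match i, j with
  | none, none => exact absurd rfl hij
  | none, some t => exact base x hx t y hy
  | some s, none =>
    have h := hE.map_star (star y * x)
    rwa [base y hy s x hx, star_zero, star_mul, star_star] at h
  | some s, some t =>
    exact map_star_mul_eq_zero_of_mem_wordSpace hE hA (by simpa using hij) hx hy

theorem mem_wordSpace_of_centered {t : ι} {a : N} (ha : a ∈ A t) (hEa : E a = 0) :
    a ∈ wordSpace E A t :=
  Submodule.subset_span ⟨a, [], ⟨by simp, by simpa using ⟨ha, hEa⟩⟩, by simp⟩

/-- A linear map carries `wordSpace` into a subspace as soon as it does so for reduced words. -/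
theorem map_mem_of_mem_wordSpace (φ : N →ₗ[ℂ] N) (V : Submodule ℂ N) {t : ι}
    (h : ∀ a l, IsReducedWord E A ((t, a) :: l) → φ (a * (l.map Prod.snd).prod) ∈ V)
    {y : N} (hy : y ∈ wordSpace E A t) : φ y ∈ V := by
  have hle : wordSpace E A t ≤ V.comap φ := by
    refine Submodule.span_le.2 ?_
    rintro _ ⟨a, l, hl, rfl⟩
    exact h a l hl
  exact hle hy

theorem IsReducedWord.cons {t : ι} {a : N} (ha : a ∈ A t) (hEa : E a = 0) {p : ι × N}
    {l : List (ι × N)} (hpt : p.1 ≠ t) (hl : IsReducedWord E A (p :: l)) :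
    IsReducedWord E A ((t, a) :: p :: l) := by
  refine ⟨List.isChain_cons_cons.2 ⟨hpt.symm, hl.1⟩, ?_⟩
  rw [List.forall_mem_cons]
  exact ⟨⟨ha, hEa⟩, hl.2⟩

theorem centered_mul_mem_wordSpace (hE : IsConditionalExpectation E B) (hBA : ∀ t, B ≤ A t)
    {t : ι} {a : N} (ha : a ∈ A t) (hEa : E a = 0) {i : Option ι} (hi : i ≠ some t) {y : N}
    (hy : y ∈ freeSummand E A B i) : a * y ∈ wordSpace E A t := by
  match i with
  | none =>
    refine mem_wordSpace_of_centered (mul_mem ha (hBA t hy)) ?_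
    have hy' : y ∈ B := hy
    have h := hE.map_star (star y * star a)
    rwa [hE.map_mul_left _ (star_mem hy'), hE.map_star a, hEa, star_zero, mul_zero, star_zero,
      star_mul, star_star, star_star] at h
  | some s =>
    refine map_mem_of_mem_wordSpace (LinearMap.mulLeft ℂ a) _ (fun b l hl => ?_) hy
    have hst : s ≠ t := by simpa using hi
    exact Submodule.subset_span ⟨a, (s, b) :: l, hl.cons ha hEa hst, by simp⟩

theorem base_mul_mem_freeSummand (hE : IsConditionalExpectation E B) (hBA : ∀ t, B ≤ A t)
    {b : N} (hb : b ∈ B) {i : Option ι} {y : N} (hy : y ∈ freeSummand E A B i) :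
    b * y ∈ freeSummand E A B i := by
  match i with
  | none => exact B.mul_mem hb hy
  | some s =>
    refine map_mem_of_mem_wordSpace (LinearMap.mulLeft ℂ b) _ (fun a l hl => ?_) hy
    have ha := hl.2 _ List.mem_cons_self
    refine Submodule.subset_span ⟨b * a, l, ⟨?_, ?_⟩, by simp [mul_assoc]⟩
    · exact List.isChain_cons.2 (List.isChain_cons.1 hl.1)
    · rw [List.forall_mem_cons]
      refine ⟨⟨mul_mem (hBA s hb) ha.1, ?_⟩, fun p hp => hl.2 p (List.mem_cons_of_mem _ hp)⟩
      simp [hE.map_mul_left b hb, ha.2]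

theorem mul_mem_iSup_freeSummand (hE : IsConditionalExpectation E B) (hBA : ∀ t, B ≤ A t)
    {t : ι} {a : N} (ha : a ∈ A t) {y : N} (hy : y ∈ ⨆ i, freeSummand E A B i) :
    a * y ∈ ⨆ i, freeSummand E A B i := by
  have hcenter : ∀ c ∈ A t, c - E c ∈ A t ∧ E (c - E c) = 0 := fun c hc =>
    ⟨sub_mem hc (hBA t (hE.mem c)), by rw [map_sub, hE.map_of_mem _ (hE.mem c), sub_self]⟩
  have base : ∀ b ∈ B, ∀ i, ∀ y ∈ freeSummand E A B i, b * y ∈ ⨆ i, freeSummand E A B i :=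
    fun b hb i y hy => Submodule.mem_iSup_of_mem i (base_mul_mem_freeSummand hE hBA hb hy)
  have centered : ∀ c ∈ A t, ∀ i, i ≠ some t → ∀ y ∈ freeSummand E A B i,
      c * y ∈ ⨆ i, freeSummand E A B i := by
    intro c hc i hi y hy
    have h := add_mem (base (E c) (hE.mem c) i y hy) (Submodule.mem_iSup_of_mem (some t)
      (centered_mul_mem_wordSpace hE hBA (hcenter c hc).1 (hcenter c hc).2 hi hy))
    rwa [← add_mul, add_sub_cancel] at h
  have one_mem : (1 : N) ∈ freeSummand E A B none := B.one_mem
  suffices h : ∀ i, freeSummand E A B i ≤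
      (⨆ i, freeSummand E A B i).comap (LinearMap.mulLeft ℂ a) from iSup_le h hy
  intro i y hy
  by_cases hi : i = some t
  · subst hi
    refine map_mem_of_mem_wordSpace (LinearMap.mulLeft ℂ a) (⨆ i, freeSummand E A B i)
      (fun b l hl => ?_) hy
    have hb := hl.2 _ List.mem_cons_self
    rw [LinearMap.mulLeft_apply, ← mul_assoc]
    match l with
    | [] => simpa using centered (a * b) (mul_mem ha hb.1) none (by simp) 1 one_mem
    | (s, c) :: l =>
      have hc := List.isChain_cons_cons.1 hl.1
      have hl' : IsReducedWord E A ((s, c) :: l) :=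
        ⟨hc.2, fun p hp => hl.2 p (List.mem_cons_of_mem _ hp)⟩
      refine centered (a * b) (mul_mem ha hb.1) (some s) (by simpa using hc.1.symm) _ ?_
      exact Submodule.subset_span ⟨c, l, hl', by simp⟩
  · exact centered a ha i hi y hy

/-- The algebra generated by the `A t` lies in the span of `B` and the reduced words. -/
theorem mem_iSup_freeSummand_of_mem_adjoin (hE : IsConditionalExpectation E B) (hBA : ∀ t, B ≤ A t)
    {x : N} (hx : x ∈ StarAlgebra.adjoin ℂ (⋃ t, (A t : Set N))) :
    x ∈ ⨆ i, freeSummand E A B i := by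
  set D := ⨆ i, freeSummand E A B i
  have one_mem : (1 : N) ∈ D := Submodule.mem_iSup_of_mem none B.one_mem
  have hmul : ∀ y ∈ D, x * y ∈ D ∧ star x * y ∈ D := by
    induction hx using StarAlgebra.adjoin_induction with
    | mem x hx =>
      obtain ⟨t, ht⟩ := Set.mem_iUnion.1 hx
      exact fun y hy => ⟨mul_mem_iSup_freeSummand hE hBA ht hy,
        mul_mem_iSup_freeSummand hE hBA (star_mem (show x ∈ A t from ht)) hy⟩
    | algebraMap r =>
      intro y hy
      rw [← algebraMap_star_comm, ← Algebra.smul_def, ← Algebra.smul_def]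
      exact ⟨D.smul_mem _ hy, D.smul_mem _ hy⟩
    | add x₁ x₂ _ _ h₁ h₂ =>
      intro y hy
      rw [star_add, add_mul, add_mul]
      exact ⟨add_mem (h₁ y hy).1 (h₂ y hy).1, add_mem (h₁ y hy).2 (h₂ y hy).2⟩
    | mul x₁ x₂ _ _ h₁ h₂ =>
      intro y hy
      rw [star_mul, mul_assoc, mul_assoc]
      exact ⟨(h₁ _ (h₂ y hy).1).1, (h₂ _ (h₁ y hy).2).2⟩
    | star x _ h =>
      intro y hy
      rw [star_star]
      exact (h y hy).symm
  simpa using (hmul 1 one_mem).1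

end Words

open ComplexOrder in
/-- Voiculescu's estimate for sums of centered free elements, for a faithful state that factors
through the conditional expectation. -/
theorem FreelyIndependentOver.norm_sum_le {N : Type*} [CStarAlgebra N] [PartialOrder N]
    [StarOrderedRing N] (f : N →ₚ[ℂ] ℂ) (hf : ∀ a, f (star a * a) = 0 → a = 0)
    {E : N →ₗ[ℂ] N} {B : StarSubalgebra ℂ N} (hE : IsConditionalExpectation E B)
    (hfE : ∀ x, f (E x) = f x) {ι : Type*} [Fintype ι] {A : ι → StarSubalgebra ℂ N}
    (hBA : ∀ t, B ≤ A t) (hA : FreelyIndependentOver E A) (Z : ι → N) (hZA : ∀ t, Z t ∈ A t)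
    (hZE : ∀ t, E (Z t) = 0) {K : ℝ} (hK : 0 ≤ K) (hZK : ∀ t, ‖Z t‖ ≤ K) :
    ‖∑ t, Z t‖ ≤ (2 * √(Fintype.card ι) + 1) * K := by
  let V : Option ι → Submodule ℂ f.PreGNS := fun i =>
    (freeSummand E A B i).map f.toPreGNS.toLinearMap
  have hsup : ⨆ i, V i = (⨆ i, freeSummand E A B i).map f.toPreGNS.toLinearMap :=
    (Submodule.map_iSup _ _).symm
  refine f.norm_le_of_preGNS_bound hf (StarAlgebra.adjoin ℂ (⋃ t, (A t : Set N)))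
    (sum_mem fun t _ => StarAlgebra.subset_adjoin ℂ _ (Set.mem_iUnion.2 ⟨t, hZA t⟩))
    (by positivity) fun x hx => ?_
  have hbound := norm_sum_le_of_free_action V
    (T := fun t => (f.leftMulMapPreGNS (Z t)).toLinearMap) (K := K) (x := f.toPreGNS x)
  simp only [ContinuousLinearMap.coe_coe, PositiveLinearMap.leftMulMapPreGNS_apply,
    PositiveLinearMap.ofPreGNS_toPreGNS, ← map_sum, ← Finset.sum_mul] at hbound
  refine hbound ?_ hK ?_ ?_ ?_ ?_
  · rintro i j hij _ ⟨y, hy, rfl⟩ _ ⟨z, hz, rfl⟩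
    have h := map_star_mul_eq_zero_of_mem_freeSummand hE hA hij hy hz
    have h' : f (star y * z) = 0 := by rw [← hfE, h, map_zero]
    exact h'
  · intro t y
    exact (f.leftMulMapPreGNS (Z t)).le_of_opNorm_le
      ((LinearMap.mkContinuous_norm_le _ (norm_nonneg (Z t)) _).trans (hZK t)) y
  · rintro t i hi _ ⟨y, hy, rfl⟩
    exact ⟨Z t * y, centered_mul_mem_wordSpace hE hBA (hZA t) (hZE t) hi hy, rfl⟩
  · rintro t _ ⟨y, hy, rfl⟩
    rw [hsup]
    exact ⟨Z t * y, mul_mem_iSup_freeSummand hE hBA (hZA t)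
      (Submodule.mem_iSup_of_mem (some t) hy), rfl⟩
  · rw [hsup]
    exact ⟨x, mem_iSup_freeSummand_of_mem_adjoin hE hBA hx, rfl⟩

/-- averaging trick / free law of large numbers: if the centered
variables `Z_t = ι_t(X_i) ι₀(Y) ι_t(X_j) − ι₀(η_{i,j}(Y))` are free over `B`,
`E_B`-centered and satisfy `‖Z_t‖ ≤ 8R‖Y‖`, then
`‖(1/m) Σ_t ι_t(X_i) ι₀(Y) ι_t(X_j) − ι₀(η_{i,j}(Y))‖ ≤ 24 R ‖Y‖ / √m`. -/
theorem stmt11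
    {N : Type*} [NormedRing N] [StarRing N] [CStarRing N] [NormedAlgebra ℂ N]
    [StarModule ℂ N] [CompleteSpace N]
    (τ : N →ₗ[ℂ] ℂ)
    (hτ1 : τ 1 = 1)
    (hτtr : ∀ a b : N, τ (a * b) = τ (b * a))
    (hτpos : ∀ a : N, 0 ≤ (τ (star a * a)).re ∧ (τ (star a * a)).im = 0)
    (hτfaith : ∀ a : N, τ (star a * a) = 0 → a = 0)
    (B : StarSubalgebra ℂ N) (E : N →ₗ[ℂ] N)
    (hEmem : ∀ x : N, E x ∈ B)
    (hEid : ∀ b ∈ B, E b = b)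
    (hEbimod : ∀ b ∈ B, ∀ b' ∈ B, ∀ x : N, E (b * x * b') = b * E x * b')
    (hEpos : ∀ x : N, ∃ y : N, E (star x * x) = star y * y)
    (hEtr : ∀ x : N, τ (E x) = τ x)
    (m : ℕ) (hm : 1 ≤ m) (R : ℝ) (hR : 0 ≤ R)
    -- W t = ι_t(X_i), V t = ι_t(X_j), Y₀ = ι₀(Y), c = ι₀(η_{i,j}(Y))
    (W V : Fin m → N) (Y₀ c : N)
    (hcent : ∀ t, E (W t * Y₀ * V t - c) = 0)
    (hbound : ∀ t, ‖W t * Y₀ * V t - c‖ ≤ 8 * R * ‖Y₀‖)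
    (hfree : FreelyIndependentOver E
      (fun t : Fin m => StarAlgebra.adjoin ℂ
        (insert (W t * Y₀ * V t - c) (B : Set N)))) :
    ‖(m : ℂ)⁻¹ • (∑ t, W t * Y₀ * V t) - c‖ ≤ 24 * R * ‖Y₀‖ / Real.sqrt m := by
  open ComplexOrder in
  let _ : CStarAlgebra N := {}
  let _ : PartialOrder N := CStarAlgebra.spectralOrder N
  have _ : StarOrderedRing N := CStarAlgebra.spectralOrderedRing N
  have hE : IsConditionalExpectation E B :=
    { mem := hEmem
      map_of_mem := hEid
      map_mul_left := fun b hb x => by simpa using hEbimod b hb 1 (one_mem B) x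
      map_star := E.map_star_of_isSelfAdjoint fun x => by
        obtain ⟨y, hy⟩ := hEpos x
        rw [hy]
        exact IsSelfAdjoint.star_mul_self y }
  let f : N →ₚ[ℂ] ℂ := PositiveLinearMap.mk₀ τ fun x hx => by
    obtain ⟨y, rfl⟩ := CStarAlgebra.nonneg_iff_eq_star_mul_self.1 hx
    exact Complex.nonneg_iff.2 ⟨(hτpos y).1, (hτpos y).2.symm⟩
  have hsum := FreelyIndependentOver.norm_sum_le f hτfaith hE hEtr
    (fun t b hb => StarAlgebra.subset_adjoin ℂ _ (Set.mem_insert_of_mem _ hb)) hfree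
    (fun t => W t * Y₀ * V t - c)
    (fun t => StarAlgebra.subset_adjoin ℂ _ (Set.mem_insert _ _)) hcent
    (K := 8 * R * ‖Y₀‖) (by positivity) hbound
  rw [Fintype.card_fin] at hsum
  have hm' : (0 : ℝ) < m := by exact_mod_cast hm
  have hsqrt : 1 ≤ √(m : ℝ) := Real.one_le_sqrt.2 (by exact_mod_cast hm)
  have havg : (m : ℂ)⁻¹ • (∑ t, W t * Y₀ * V t) - c
      = (m : ℂ)⁻¹ • ∑ t, (W t * Y₀ * V t - c) := by
    have hmC : (m : ℂ) ≠ 0 := by exact_mod_cast hm'.ne'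
    rw [Finset.sum_sub_distrib, smul_sub, Finset.sum_const, Finset.card_univ, Fintype.card_fin,
      ← Nat.cast_smul_eq_nsmul ℂ, smul_smul, inv_mul_cancel₀ hmC, one_smul]
  rw [havg, norm_smul, norm_inv, Complex.norm_natCast, inv_mul_le_iff₀ hm']
  calc _ ≤ (2 * √m + 1) * (8 * R * ‖Y₀‖) := hsum
    _ ≤ (3 * √m) * (8 * R * ‖Y₀‖) := by gcongr; linarith
    _ = m * (24 * R * ‖Y₀‖ / √m) := by
      field_simp
      rw [Real.sq_sqrt hm'.le]
      ring
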